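/- arXiv:2302.11390 — 2 statements merged into one kernel-verified Lean document; each statement's English description precedes it below -/
import Mathlib

section
/- Let 𝒫 be a family of finite posets, h = h(𝒫) ≥ 2 and w = w(𝒫). Then: (1) every C_h-free finite poset is 𝒫-free; and (2) every 𝒫-free finite poset P has a C_h-free subposet obtained by the removal of at most 2·(h²w²/|P|)^{1/(hw²)}·|P|² edges. -/
/-- A strict partial order relation: irreflexive and transitive. -/
def IsStrictOrd {α : Type*} (r : α → α → Prop) : Prop :=
  (∀ x, ¬ r x x) ∧ (∀ ⦃x y z⦄, r x y → r y z → r x z)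

/-- An order-preserving map between relations. -/
def IsPosetHom {β : Type*} {α : Type*} (q : β → β → Prop) (p : α → α → Prop)
    (f : β → α) : Prop :=
  ∀ ⦃x y⦄, q x y → p (f x) (f y)

/-- The homomorphism density `t(Q,P)`: the probability that a uniformly random map from the
ground set of `Q` to the ground set of `P` is order-preserving. -/
noncomputable def homDensity {β : Type*} {α : Type*} [Fintype β] [Fintype α]
    (q : β → β → Prop) (p : α → α → Prop) : ℝ :=
  (Nat.card {f : β → α // IsPosetHom q p f} : ℝ) / (Fintype.card α : ℝ) ^ (Fintype.card β)

/-- `HasChain p h` means the relation `p` contains a copy of the chain `C_h`,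
i.e. elements `x_1 ≺ x_2 ≺ ⋯ ≺ x_h`. -/
def HasChain {α : Type*} (p : α → α → Prop) (h : ℕ) : Prop :=
  ∃ f : Fin h → α, ∀ ⦃i j : Fin h⦄, i < j → p (f i) (f j)

/-- The height of a poset: the maximum number of elements of a chain. -/
noncomputable def posetHeight {α : Type*} [Fintype α] (p : α → α → Prop) : ℕ :=
  sSup {n | HasChain p n}

/-- The width of a poset: the maximum number of elements of an antichain. -/
noncomputable def posetWidth {α : Type*} [Fintype α] (p : α → α → Prop) : ℕ :=
  sSup {n | ∃ s : Finset α, s.card = n ∧ ∀ x ∈ s, ∀ y ∈ s, ¬ p x y}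

/-- `SubposetRel p' p` : the relation `p'` is contained in `p` (a subposet on the same ground set,
obtained by removing edges). -/
def SubposetRel {α : Type*} (p' p : α → α → Prop) : Prop :=
  ∀ ⦃x y⦄, p' x y → p x y

/-- The number of removed edges: pairs `(x,y)` with `x ≺ y` in `p` but not in `p'`. -/
noncomputable def removedEdges {α : Type*} [Fintype α] (p p' : α → α → Prop) : ℕ :=
  Nat.card {e : α × α // p e.1 e.2 ∧ ¬ p' e.1 e.2}

/-- The chain `C_h` with `h` elements. -/
def chainRel (h : ℕ) : Fin h → Fin h → Prop := fun i j => i < j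

/-- `P` contains `Q` as a (not necessarily induced) subposet:
there is an injective order-preserving map from `Q` to `P`. -/
def ContainsAsSubposet {β : Type*} {α : Type*} (q : β → β → Prop)
    (p : α → α → Prop) : Prop :=
  ∃ f : β → α, Function.Injective f ∧ IsPosetHom q p f

/-- A finite poset with ground set `Fin n`. -/
structure FinPoset where
  n : ℕ
  rel : Fin n → Fin n → Prop
  strict : IsStrictOrd rel

/-- The height of a family of finite posets: the minimum height of a member. -/
noncomputable def famHeight (Ps : Set FinPoset) : ℕ :=
  sInf {m | ∃ P ∈ Ps, posetHeight P.rel = m}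

/-- The width of a family of finite posets: the minimum width of a member of minimum height. -/
noncomputable def famWidth (Ps : Set FinPoset) : ℕ :=
  sInf {m | ∃ P ∈ Ps, posetHeight P.rel = famHeight Ps ∧ posetWidth P.rel = m}

/-- Jensen's inequality for stars: the density of `k`-fold stars in a bipartite relation is at
least the `k`-th power of its edge density. -/
theorem star_density_le {X Y : Type*} [Fintype X] [Fintype Y] [Nonempty X] [Nonempty Y]
    (r : X → Y → Prop) (k : ℕ) :
    ((Nat.card {e : X × Y // r e.1 e.2} : ℝ) / (Fintype.card X * Fintype.card Y)) ^ k ≤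
      (Nat.card {e : X × (Fin k → Y) // ∀ j, r e.1 (e.2 j)} : ℝ) /
        (Fintype.card X * (Fintype.card Y : ℝ) ^ k) := by
  classical
  have hX : (0 : ℝ) < Fintype.card X := by exact_mod_cast Fintype.card_pos
  have hY : (0 : ℝ) < Fintype.card Y := by exact_mod_cast Fintype.card_pos
  set d : X → ℝ := fun x => (Nat.card {y // r x y} : ℝ) with hd
  have h1 : (Nat.card {e : X × Y // r e.1 e.2} : ℝ) = ∑ x, d x := by
    rw [Nat.card_congr (Equiv.subtypeProdEquivSigmaSubtype r), Nat.card_sigma]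
    push_cast
    rfl
  have h2 : (Nat.card {e : X × (Fin k → Y) // ∀ j, r e.1 (e.2 j)} : ℝ) = ∑ x, d x ^ k := by
    rw [Nat.card_congr (Equiv.subtypeProdEquivSigmaSubtype
      (fun (x : X) (y : Fin k → Y) => ∀ j, r x (y j))), Nat.card_sigma]
    push_cast
    refine Finset.sum_congr rfl fun x _ => ?_
    rw [Nat.card_congr (Equiv.subtypePiEquivPi (p := fun (_ : Fin k) y => r x y)), Nat.card_pi]
    simp [hd]
  rw [h1, h2]
  rcases k with _ | k
  · simp [hX.ne']
  have h3 := pow_sum_div_card_le_sum_pow (s := Finset.univ) (f := d)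
    (fun x _ => Nat.cast_nonneg _) k
  rw [Finset.card_univ] at h3
  calc ((∑ x, d x) / (Fintype.card X * Fintype.card Y)) ^ (k + 1)
      = ((∑ x, d x) ^ (k + 1) / (Fintype.card X : ℝ) ^ k) /
          (Fintype.card X * (Fintype.card Y : ℝ) ^ (k + 1)) := by
        rw [div_pow, mul_pow, div_div]
        congr 1
        ring
    _ ≤ _ := by gcongr

/-- The density of complete bipartite `k × k` configurations in a bipartite relation is at least
the `k ^ 2`-th power of its edge density. -/
theorem biclique_density_le {X Y : Type*} [Fintype X] [Fintype Y] [Nonempty X] [Nonempty Y]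
    (r : X → Y → Prop) (k : ℕ) :
    ((Nat.card {e : X × Y // r e.1 e.2} : ℝ) / (Fintype.card X * Fintype.card Y)) ^ k ^ 2 ≤
      (Nat.card {e : (Fin k → X) × (Fin k → Y) // ∀ i j, r (e.1 i) (e.2 j)} : ℝ) /
        ((Fintype.card X * Fintype.card Y : ℝ) ^ k) := by
  have h1 := star_density_le r k
  have h2 := star_density_le (fun (y : Fin k → Y) (x : X) => ∀ j, r x (y j)) k
  have e1 : Nat.card {e : (Fin k → Y) × X // ∀ j, r e.2 (e.1 j)} =
      Nat.card {e : X × (Fin k → Y) // ∀ j, r e.1 (e.2 j)} :=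
    Nat.card_congr ((Equiv.prodComm _ _).subtypeEquiv fun _ => Iff.rfl)
  have e2 : Nat.card {e : (Fin k → Y) × (Fin k → X) // ∀ i j, r (e.2 i) (e.1 j)} =
      Nat.card {e : (Fin k → X) × (Fin k → Y) // ∀ i j, r (e.1 i) (e.2 j)} :=
    Nat.card_congr ((Equiv.prodComm _ _).subtypeEquiv fun _ => Iff.rfl)
  rw [e1, e2] at h2
  simp only [Fintype.card_pi, Finset.prod_const, Finset.card_univ, Fintype.card_fin,
    Nat.cast_pow] at h2
  calc _ = (((Nat.card {e : X × Y // r e.1 e.2} : ℝ) /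
            (Fintype.card X * Fintype.card Y)) ^ k) ^ k := by rw [← pow_mul, sq]
    _ ≤ ((Nat.card {e : X × (Fin k → Y) // ∀ j, r e.1 (e.2 j)} : ℝ) /
        (Fintype.card X * (Fintype.card Y : ℝ) ^ k)) ^ k := by gcongr
    _ ≤ _ := by
      rw [mul_comm (Fintype.card X : ℝ), mul_pow, mul_comm ((Fintype.card X : ℝ) ^ k)]
      exact h2

/-- The number of homomorphisms from the `w`-fold blow-up of the chain `C_h` is bounded below by a
power of the density of chains. -/
theorem chain_blowup_count {α : Type*} [Fintype α] [Nonempty α] {p : α → α → Prop}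
    (hp : IsStrictOrd p) (h w : ℕ) :
    ((Nat.card {f : Fin h → α // ∀ ⦃i j⦄, i < j → p (f i) (f j)} : ℝ) /
        (Fintype.card α : ℝ) ^ h) ^ w ^ 2 * (Fintype.card α : ℝ) ^ (h * w) ≤
      Nat.card {g : Fin h × Fin w → α // ∀ ⦃a b⦄, a.1 < b.1 → p (g a) (g b)} := by
  classical
  have hα : (0 : ℝ) < Fintype.card α := by exact_mod_cast Fintype.card_pos
  let E := Equiv.piEquivPiSubtypeProd (fun i : Fin h => Even i.val) (fun _ => α)
  let X := {i : Fin h // Even i.val} → α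
  let Y := {i : Fin h // ¬ Even i.val} → α
  let r : X → Y → Prop := fun x y => ∀ ⦃i j⦄, i < j → p (E.symm (x, y) i) (E.symm (x, y) j)
  have key := biclique_density_le r w
  have hcard : (Fintype.card X * Fintype.card Y : ℝ) = (Fintype.card α : ℝ) ^ h := by
    have := Fintype.card_congr E
    rw [Fintype.card_prod] at this
    rw [← Nat.cast_mul, ← this]
    simp
  have e1 : Nat.card {e : X × Y // r e.1 e.2} =
      Nat.card {f : Fin h → α // ∀ ⦃i j⦄, i < j → p (f i) (f j)} :=
    Nat.card_congr (E.symm.subtypeEquiv fun _ => Iff.rfl)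
  let F : (Fin w → X) × (Fin w → Y) → (Fin h × Fin w → α) :=
    fun e a => E.symm (e.1 a.2, e.2 a.2) a.1
  have hF : Function.Injective F := by
    intro e e' hee
    have : ∀ j, (e.1 j, e.2 j) = (e'.1 j, e'.2 j) := fun j =>
      E.symm.injective (funext fun i => congrFun hee (i, j))
    exact Prod.ext (funext fun j => (Prod.ext_iff.1 (this j)).1)
      (funext fun j => (Prod.ext_iff.1 (this j)).2)
  have heven : ∀ (x : X) (y y' : Y) (i : Fin h), Even i.val →
      E.symm (x, y) i = E.symm (x, y') i := by
    intro x y y' i hi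
    simp [E, Equiv.piEquivPiSubtypeProd, hi]
  have hodd : ∀ (x x' : X) (y : Y) (i : Fin h), ¬ Even i.val →
      E.symm (x, y) i = E.symm (x', y) i := by
    intro x x' y i hi
    simp only [E, Equiv.piEquivPiSubtypeProd, Equiv.coe_fn_symm_mk, hi, dif_neg, not_false_eq_true]
  have hdiff : ∀ e : (Fin w → X) × (Fin w → Y), (∀ i j, r (e.1 i) (e.2 j)) →
      ∀ a b : Fin h × Fin w, a.1 < b.1 → (Even a.1.val ↔ ¬ Even b.1.val) → p (F e a) (F e b) := by
    intro e he a b hab hpar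
    by_cases ha : Even a.1.val
    · have h1 := he a.2 b.2 hab
      rwa [heven _ _ (e.2 a.2) _ ha, hodd _ (e.1 b.2) _ _ (hpar.1 ha)] at h1
    · have hb : Even b.1.val := by tauto
      have h1 := he b.2 a.2 hab
      rwa [hodd _ (e.1 a.2) _ _ ha, heven _ _ (e.2 b.2) _ hb] at h1
  have hhom : ∀ e : (Fin w → X) × (Fin w → Y), (∀ i j, r (e.1 i) (e.2 j)) →
      ∀ ⦃a b : Fin h × Fin w⦄, a.1 < b.1 → p (F e a) (F e b) := by
    intro e he a b hab
    by_cases hpar : Even a.1.val ↔ ¬ Even b.1.val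
    · exact hdiff e he a b hab hpar
    · have hlt : a.1.val + 1 < b.1.val := by
        have : a.1.val < b.1.val := hab
        by_contra hcon
        have hb : b.1.val = a.1.val + 1 := by omega
        rw [hb, Nat.even_add_one] at hpar
        tauto
      let c : Fin h × Fin w := (⟨a.1.val + 1, by omega⟩, a.2)
      have hac : Even c.1.val ↔ ¬ Even a.1.val := Nat.even_add_one
      exact hp.2 (hdiff e he a c (Fin.lt_def.2 (Nat.lt_succ_self _)) (by tauto))
        (hdiff e he c b (Fin.lt_def.2 hlt) (by tauto))
  have e2 : Nat.card {e : (Fin w → X) × (Fin w → Y) // ∀ i j, r (e.1 i) (e.2 j)} ≤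
      Nat.card {g : Fin h × Fin w → α // ∀ ⦃a b⦄, a.1 < b.1 → p (g a) (g b)} :=
    Nat.card_le_card_of_injective (fun e => ⟨F e.1, hhom e.1 e.2⟩)
      fun e e' hee => Subtype.ext (hF (Subtype.ext_iff.1 hee))
  rw [hcard, e1, le_div_iff₀ (by positivity), ← pow_mul] at key
  exact key.trans (by exact_mod_cast e2)

/-- There are few non-injective maps into a finite type. -/
theorem card_not_injective_lt {ι α : Type*} [Fintype ι] [Fintype α] [Nonempty ι] [Nonempty α] :
    Nat.card {g : ι → α // ¬ Function.Injective g} <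
      Fintype.card ι ^ 2 * Fintype.card α ^ (Fintype.card ι - 1) := by
  classical
  have h1 : ∀ a ∈ (Finset.univ : Finset ι).offDiag,
      (Finset.univ.filter fun g : ι → α => g a.1 = g a.2).card ≤
        Fintype.card α ^ (Fintype.card ι - 1) := by
    intro a ha
    have hne : a.1 ≠ a.2 := (Finset.mem_offDiag.1 ha).2.2
    have : Fintype.card ({x : ι // x ≠ a.2} → α) = Fintype.card α ^ (Fintype.card ι - 1) := by
      simp
    rw [← this, ← Finset.card_univ]
    refine Finset.card_le_card_of_injOn (fun g x => g x)
      (fun _ _ => Finset.mem_coe.2 (Finset.mem_univ _)) ?_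
    intro g hg g' hg' hgg
    simp only [Finset.coe_filter, Finset.mem_univ, true_and, Set.mem_ofPred_eq] at hg hg'
    funext x
    by_cases hx : x = a.2
    · subst hx
      rw [← hg, ← hg']
      exact congrFun hgg ⟨a.1, hne⟩
    · exact congrFun hgg ⟨x, hx⟩
  have h2 : (Finset.univ.filter fun g : ι → α => ¬ Function.Injective g) ⊆
      (Finset.univ : Finset ι).offDiag.biUnion
        fun a => Finset.univ.filter fun g : ι → α => g a.1 = g a.2 := by
    intro g hg
    simp only [Finset.mem_filter, Finset.mem_univ, true_and, Function.Injective, not_forall] at hg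
    obtain ⟨a, b, hab, hne⟩ := hg
    simp only [Finset.mem_biUnion, Finset.mem_offDiag, Finset.mem_filter, Finset.mem_univ, true_and]
    exact ⟨(a, b), hne, hab⟩
  rw [Nat.card_eq_fintype_card, Fintype.card_subtype]
  calc _ ≤ _ := Finset.card_le_card h2
    _ ≤ _ := Finset.card_biUnion_le_card_mul _ _ _ h1
    _ < _ := by
      have h3 : 0 < Fintype.card ι := Fintype.card_pos
      have h4 : 0 < Fintype.card α := Fintype.card_pos
      gcongr
      rw [Finset.offDiag_card, Finset.card_univ, sq]
      have : 0 < Fintype.card ι * Fintype.card ι := by positivity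
      omega

theorem HasChain.le_card {α : Type*} [Fintype α] {p : α → α → Prop} (hp : IsStrictOrd p) {n : ℕ}
    (hn : HasChain p n) : n ≤ Fintype.card α := by
  obtain ⟨f, hf⟩ := hn
  have hinj : Function.Injective f := by
    intro i j hij
    rcases lt_trichotomy i j with h | h | h
    · exact absurd (hij ▸ hf h) (hp.1 _)
    · exact h
    · exact absurd (hij ▸ hf h) (hp.1 _)
  simpa using Fintype.card_le_of_injective f hinj

theorem HasChain.mono {α : Type*} {p : α → α → Prop} {m n : ℕ} (hmn : m ≤ n)
    (hn : HasChain p n) : HasChain p m := by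
  obtain ⟨f, hf⟩ := hn
  exact ⟨fun i => f (Fin.castLE hmn i), fun i j hij => hf hij⟩

theorem HasChain.le_posetHeight {α : Type*} [Fintype α] {p : α → α → Prop} (hp : IsStrictOrd p)
    {n : ℕ} (hn : HasChain p n) : n ≤ posetHeight p :=
  le_csSup ⟨Fintype.card α, fun _ hm => HasChain.le_card hp hm⟩ hn

theorem hasChain_posetHeight {α : Type*} [Fintype α] {p : α → α → Prop} (hp : IsStrictOrd p) :
    HasChain p (posetHeight p) :=
  Nat.sSup_mem (s := {n | HasChain p n}) ⟨0, fun i => i.elim0, fun i => i.elim0⟩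
    ⟨Fintype.card α, fun _ hm => HasChain.le_card hp hm⟩

theorem card_le_posetWidth {α : Type*} [Fintype α] {p : α → α → Prop} {s : Finset α}
    (hs : ∀ x ∈ s, ∀ y ∈ s, ¬ p x y) : s.card ≤ posetWidth p :=
  le_csSup ⟨Fintype.card α, fun _ ⟨t, ht, _⟩ => ht ▸ t.card_le_univ⟩ ⟨s, rfl, hs⟩

/-- `f` is a chain with `i + 1` elements and greatest element `x`. -/
def IsChainTo {α : Type*} (p : α → α → Prop) (i : ℕ) (x : α) (f : Fin (i + 1) → α) : Prop :=
  (∀ ⦃a b⦄, a < b → p (f a) (f b)) ∧ f (Fin.last i) = x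

theorem isChainTo_zero {α : Type*} (p : α → α → Prop) (x : α) : IsChainTo p 0 x fun _ => x :=
  ⟨fun a b hab => absurd (Fin.lt_def.1 hab) (by omega), rfl⟩

theorem IsChainTo.snoc {α : Type*} {p : α → α → Prop} (hp : IsStrictOrd p) {i : ℕ} {x y : α}
    {f : Fin (i + 1) → α} (hf : IsChainTo p i y f) (hyx : p y x) :
    IsChainTo p (i + 1) x (Fin.snoc f x : Fin (i + 2) → α) := by
  refine ⟨fun a b hab => ?_, by simp⟩
  induction b using Fin.lastCases with
  | last =>
    induction a using Fin.lastCases with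
    | last => exact absurd hab (lt_irrefl _)
    | cast a =>
      simp only [Fin.snoc_castSucc, Fin.snoc_last]
      rcases (Fin.le_last a).lt_or_eq with h | h
      · exact hp.2 (hf.1 h) (hf.2 ▸ hyx)
      · rw [h, hf.2]; exact hyx
  | cast b =>
    induction a using Fin.lastCases with
    | last => exact absurd hab (not_lt.2 (Fin.le_last _))
    | cast a =>
      simp only [Fin.snoc_castSucc]
      exact hf.1 (by simpa using hab)

/-- A finite poset of height `h` has a strictly monotone rank function into `Fin h`. -/
theorem exists_rank {α : Type*} [Fintype α] {p : α → α → Prop} (hp : IsStrictOrd p) :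
    ∃ ρ : α → Fin (posetHeight p), ∀ ⦃x y⦄, p x y → ρ x < ρ y := by
  let S : α → Set ℕ := fun x => {m | ∃ f, IsChainTo p m x f}
  have hlt : ∀ x, ∀ m ∈ S x, m < posetHeight p := fun x m ⟨f, hf⟩ =>
    Nat.lt_of_succ_le (HasChain.le_posetHeight hp ⟨f, hf.1⟩)
  have hbdd : ∀ x, BddAbove (S x) := fun x => ⟨posetHeight p, fun m hm => (hlt x m hm).le⟩
  have hmem : ∀ x, sSup (S x) ∈ S x := fun x =>
    Nat.sSup_mem ⟨0, _, isChainTo_zero p x⟩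
      (hbdd x)
  refine ⟨fun x => ⟨sSup (S x), hlt x _ (hmem x)⟩, fun x y hxy => ?_⟩
  obtain ⟨f, hf⟩ := hmem x
  exact Fin.lt_def.2 (Nat.lt_of_succ_le (le_csSup (hbdd y) ⟨_, hf.snoc hp hxy⟩))

/-- A finite poset of height `h` and width `w` is a subposet of the `w`-fold blow-up of `C_h`. -/
theorem containsAsSubposet_of_blowup {α β : Type*} [Fintype β] {q : β → β → Prop}
    (hq : IsStrictOrd q) {p : α → α → Prop}
    {g : Fin (posetHeight q) × Fin (posetWidth q) → α} (hg : Function.Injective g)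
    (hgp : ∀ ⦃a b⦄, a.1 < b.1 → p (g a) (g b)) : ContainsAsSubposet q p := by
  classical
  obtain ⟨ρ, hρ⟩ := exists_rank hq
  have hfib : ∀ i, ∃ e : {x // ρ x = i} → Fin (posetWidth q), Function.Injective e := by
    intro i
    have hle : (Finset.univ.filter fun x => ρ x = i).card ≤ posetWidth q := by
      refine card_le_posetWidth fun x hx y hy hxy => ?_
      simp only [Finset.mem_filter, Finset.mem_univ, true_and] at hx hy
      exact absurd (hρ hxy) (by rw [hx, hy]; exact lt_irrefl _)
    rw [← Fintype.card_subtype] at hle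
    obtain ⟨e⟩ := Function.Embedding.nonempty_of_card_le
      (α := {x // ρ x = i}) (β := Fin (posetWidth q)) (by simpa using hle)
    exact ⟨e, e.injective⟩
  choose e he using hfib
  refine ⟨fun x => g (ρ x, e (ρ x) ⟨x, rfl⟩), fun x y hxy => ?_, fun x y hxy => hgp (hρ hxy)⟩
  have h1 := hg hxy
  rw [Prod.mk.injEq] at h1
  obtain ⟨h1, h2⟩ := h1
  have h3 : ∀ i (hi : ρ y = i), e i ⟨y, hi⟩ = e (ρ y) ⟨y, rfl⟩ := by rintro i rfl; rfl
  rw [← h3 _ h1.symm] at h2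
  exact congrArg Subtype.val (he _ h2)

/-- Iterated richness: `RichLevel p c (i + 1) x` says that at least `c` elements below `x` satisfy
`RichLevel p c i`. -/
def RichLevel {α : Type*} (p : α → α → Prop) (c : ℝ) : ℕ → α → Prop
  | 0, _ => True
  | i + 1, x => c ≤ Nat.card {y // p y x ∧ RichLevel p c i y}

theorem RichLevel.of_succ {α : Type*} [Finite α] {p : α → α → Prop} {c : ℝ} :
    ∀ {i : ℕ} {x : α}, RichLevel p c (i + 1) x → RichLevel p c i x
  | 0, _, _ => trivial
  | i + 1, x, hx => by
    refine le_trans (show c ≤ _ from hx) (Nat.cast_le.2 ?_)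
    exact Nat.card_le_card_of_injective
      (fun y : {y // p y x ∧ RichLevel p c (i + 1) y} =>
        (⟨y.1, y.2.1, RichLevel.of_succ y.2.2⟩ : {y // p y x ∧ RichLevel p c i y}))
      fun y y' hyy => Subtype.ext (congrArg (fun z => z.1) hyy)

theorem RichLevel.anti {α : Type*} [Finite α] {p : α → α → Prop} {c : ℝ} {i j : ℕ} {x : α}
    (hij : i ≤ j) (hx : RichLevel p c j x) : RichLevel p c i x := by
  induction j, hij using Nat.le_induction with
  | base => exact hx
  | succ j _ ih => exact ih hx.of_succ

theorem RichLevel.pow_le_card_chains {α : Type*} [Fintype α] {p : α → α → Prop}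
    (hp : IsStrictOrd p) {c : ℝ} (hc : 0 ≤ c) :
    ∀ {i : ℕ} {x : α}, RichLevel p c i x → c ^ i ≤ Nat.card {f // IsChainTo p i x f}
  | 0, x, _ => by
    have : Nonempty {f // IsChainTo p 0 x f} :=
      ⟨_, isChainTo_zero p x⟩
    rw [pow_zero]
    exact_mod_cast Nat.card_pos
  | i + 1, x, hx => by
    let T := Σ y : {y // p y x ∧ RichLevel p c i y}, {f // IsChainTo p i y.1 f}
    have h1 : Nat.card T ≤ Nat.card {f // IsChainTo p (i + 1) x f} := by
      refine Nat.card_le_card_of_injective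
        (fun t : T => ⟨Fin.snoc t.2.1 x, t.2.2.snoc hp t.1.2.1⟩) ?_
      rintro ⟨⟨y, hy⟩, f, hf⟩ ⟨⟨y', hy'⟩, f', hf'⟩ htt
      have hff : f = f' := (Fin.snoc_injective2 (α := fun _ => α) (Subtype.ext_iff.1 htt)).1
      subst hff
      have : y = y' := hf.2.symm.trans hf'.2
      subst this
      rfl
    classical
    calc c ^ (i + 1) = c * c ^ i := pow_succ' _ _
      _ ≤ Nat.card {y // p y x ∧ RichLevel p c i y} * c ^ i := by
        gcongr
        exact hx
      _ = ∑ _y : {y // p y x ∧ RichLevel p c i y}, c ^ i := by simp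
      _ ≤ ∑ y : {y // p y x ∧ RichLevel p c i y}, (Nat.card {f // IsChainTo p i y.1 f} : ℝ) :=
        Finset.sum_le_sum fun y _ => RichLevel.pow_le_card_chains hp hc y.2.2
      _ = Nat.card T := by rw [Nat.card_sigma]; push_cast; rfl
      _ ≤ _ := by exact_mod_cast h1

/-- If many elements are rich at level `h`, there are many chains with `h + 1` elements. -/
theorem pow_le_card_chains {α : Type*} [Fintype α] {p : α → α → Prop}
    (hp : IsStrictOrd p) {c : ℝ} (hc : 0 ≤ c) {h : ℕ}
    (hrich : c ≤ Nat.card {x // RichLevel p c h x}) :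
    c ^ (h + 1) ≤ Nat.card {f : Fin (h + 1) → α // ∀ ⦃i j⦄, i < j → p (f i) (f j)} := by
  classical
  let T := Σ x : {x // RichLevel p c h x}, {f // IsChainTo p h x.1 f}
  have h1 : Nat.card T ≤ Nat.card {f : Fin (h + 1) → α // ∀ ⦃i j⦄, i < j → p (f i) (f j)} := by
    refine Nat.card_le_card_of_injective (fun t : T => ⟨t.2.1, t.2.2.1⟩) ?_
    rintro ⟨⟨y, hy⟩, f, hf⟩ ⟨⟨y', hy'⟩, f', hf'⟩ htt
    have hff : f = f' := Subtype.ext_iff.1 htt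
    subst hff
    have : y = y' := hf.2.symm.trans hf'.2
    subst this
    rfl
  calc c ^ (h + 1) = c * c ^ h := pow_succ' _ _
    _ ≤ Nat.card {x // RichLevel p c h x} * c ^ h := by gcongr
    _ = ∑ _x : {x // RichLevel p c h x}, c ^ h := by simp
    _ ≤ ∑ x : {x // RichLevel p c h x}, (Nat.card {f // IsChainTo p h x.1 f} : ℝ) :=
      Finset.sum_le_sum fun x _ => x.2.pow_le_card_chains hp hc
    _ = Nat.card T := by rw [Nat.card_sigma]; push_cast; rfl
    _ ≤ _ := by exact_mod_cast h1

/-- If few elements are rich at level `h`, the poset can be made `C_{h+1}`-free by removing few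
edges. -/
theorem exists_chain_free_subposet {α : Type*} [Fintype α] {p : α → α → Prop}
    (hp : IsStrictOrd p) {c : ℝ} {h : ℕ} (h1 : 1 ≤ h)
    (hrich : (Nat.card {x // RichLevel p c h x} : ℝ) ≤ c) :
    ∃ p' : α → α → Prop, IsStrictOrd p' ∧ SubposetRel p' p ∧ ¬ HasChain p' (h + 1) ∧
      (removedEdges p p' : ℝ) ≤ 2 * c * Fintype.card α := by
  classical
  let lev : α → ℕ := fun x => Nat.findGreatest (fun i => RichLevel p c i x) h
  have hlev : ∀ x, RichLevel p c (lev x) x := fun x =>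
    Nat.findGreatest_spec (P := fun i => RichLevel p c i x) (Nat.zero_le h) trivial
  refine ⟨fun x y => p x y ∧ lev x < lev y ∧ lev y < h,
    ⟨fun x hx => hp.1 x hx.1, fun x y z hxy hyz =>
      ⟨hp.2 hxy.1 hyz.1, hxy.2.1.trans hyz.2.1, hyz.2.2⟩⟩, fun x y hxy => hxy.1, ?_, ?_⟩
  · rintro ⟨f, hf⟩
    have hmono : StrictMono (fun i => lev (f i)) := fun i j hij => (hf hij).2.1
    have hle : ∀ i : ℕ, ∀ hi : i < h + 1, i ≤ lev (f ⟨i, hi⟩) := by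
      intro i
      induction i with
      | zero => exact fun _ => Nat.zero_le _
      | succ i ih =>
        intro hi
        exact Nat.succ_le_of_lt ((ih (by omega)).trans_lt
          (hmono (Fin.lt_def.2 (Nat.lt_succ_self i))))
    have h2 := hle h (Nat.lt_succ_self h)
    have h3 := (hf (i := ⟨0, by omega⟩) (j := ⟨h, by omega⟩) (Fin.lt_def.2 h1)).2.2
    omega
  · let A := {x // RichLevel p c h x}
    let B : α → Type _ := fun y => {x // p x y ∧ ¬ RichLevel p c h y ∧ lev y ≤ lev x}
    have hB : ∀ y, (Nat.card (B y) : ℝ) ≤ c := by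
      intro y
      by_cases hy : RichLevel p c h y
      · have : IsEmpty (B y) := ⟨fun x => x.2.2.1 hy⟩
        rw [Nat.card_of_isEmpty, Nat.cast_zero]
        exact (Nat.cast_nonneg _).trans hrich
      · have hlt : lev y < h :=
          lt_of_le_of_ne (Nat.findGreatest_le h) fun heq => hy (heq ▸ hlev y)
        have hnot : ¬ RichLevel p c (lev y + 1) y :=
          Nat.findGreatest_is_greatest (P := fun i => RichLevel p c i y) (Nat.lt_succ_self _) hlt
        refine le_trans (Nat.cast_le.2 ?_) (not_le.1 hnot).le
        exact Nat.card_le_card_of_injective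
          (fun x : B y => (⟨x.1, x.2.1, (hlev x.1).anti x.2.2.2⟩ :
            {x // p x y ∧ RichLevel p c (lev y) x}))
          fun x x' hxx => Subtype.ext (congrArg (fun z => z.1) hxx)
    have hcount : removedEdges p (fun x y => p x y ∧ lev x < lev y ∧ lev y < h) ≤
        Nat.card ((α × A) ⊕ (Σ y, B y)) := by
      refine Nat.card_le_card_of_injective
        (fun e => if hy : RichLevel p c h e.1.2 then Sum.inl (e.1.1, ⟨e.1.2, hy⟩)
          else Sum.inr ⟨e.1.2, e.1.1, e.2.1, hy, ?_⟩) ?_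
      · by_contra hcon
        refine e.2.2 ⟨e.2.1, not_le.1 hcon,
          lt_of_le_of_ne (Nat.findGreatest_le h) fun heq => hy ?_⟩
        have hle := hlev e.1.2
        rwa [show lev e.1.2 = h from heq] at hle
      · rintro ⟨⟨x, y⟩, he⟩ ⟨⟨x', y'⟩, he'⟩ hee
        dsimp only at hee
        split_ifs at hee
        · obtain ⟨h1, h2⟩ := Prod.ext_iff.1 (Sum.inl.inj hee)
          exact Subtype.ext (Prod.ext h1 (congrArg Subtype.val h2))
        · obtain ⟨h1, h2⟩ := Sigma.mk.inj (Sum.inr.inj hee)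
          subst h1
          have := Subtype.ext_iff.1 (eq_of_heq h2)
          simpa using this
    calc (removedEdges p (fun x y => p x y ∧ lev x < lev y ∧ lev y < h) : ℝ)
        ≤ Nat.card ((α × A) ⊕ (Σ y, B y)) := by exact_mod_cast hcount
      _ = Fintype.card α * Nat.card A + ∑ y, (Nat.card (B y) : ℝ) := by
        rw [Nat.card_sum, Nat.card_prod, Nat.card_sigma, Nat.card_eq_fintype_card (α := α)]
        push_cast
        rfl
      _ ≤ Fintype.card α * c + ∑ _y : α, c := by
        gcongr with y
        exact hB y
      _ = 2 * c * Fintype.card α := by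
        rw [Finset.sum_const, Finset.card_univ, nsmul_eq_mul]
        ring

/-- A `C_h`-chain count forcing a copy of every poset of height `h` and width `w`. -/
theorem containsAsSubposet_of_card_chains {α β : Type*} [Fintype α] [Nonempty α] [Fintype β]
    {q : β → β → Prop} (hq : IsStrictOrd q) (hh : posetHeight q ≠ 0) (hw : posetWidth q ≠ 0)
    {p : α → α → Prop} (hp : IsStrictOrd p) {ε : ℝ} (hε : 0 ≤ ε)
    (hpow : ε ^ (posetHeight q * posetWidth q ^ 2) =
      (posetHeight q : ℝ) ^ 2 * (posetWidth q : ℝ) ^ 2 / Fintype.card α)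
    (hchains : (ε * Fintype.card α) ^ posetHeight q ≤
      Nat.card {f : Fin (posetHeight q) → α // ∀ ⦃i j⦄, i < j → p (f i) (f j)}) :
    ContainsAsSubposet q p := by
  by_contra hfree
  generalize hhdef : posetHeight q = h at *
  generalize hwdef : posetWidth q = w at *
  have hα : (0 : ℝ) < Fintype.card α := by exact_mod_cast Fintype.card_pos
  have : Nonempty (Fin h) := ⟨⟨0, Nat.pos_of_ne_zero hh⟩⟩
  have : Nonempty (Fin w) := ⟨⟨0, Nat.pos_of_ne_zero hw⟩⟩
  have hnon : ∀ g : Fin h × Fin w → α, (∀ ⦃a b⦄, a.1 < b.1 → p (g a) (g b)) →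
      ¬ Function.Injective g := by
    subst hhdef hwdef
    exact fun g hg hinj => hfree (containsAsSubposet_of_blowup hq hinj hg)
  have h1 : Nat.card {g : Fin h × Fin w → α // ∀ ⦃a b⦄, a.1 < b.1 → p (g a) (g b)} ≤
      Nat.card {g : Fin h × Fin w → α // ¬ Function.Injective g} :=
    Nat.card_le_card_of_injective (fun g => ⟨g.1, hnon g.1 g.2⟩)
      fun g g' hgg => Subtype.ext (congrArg (fun z => z.1) hgg)
  have h2 := card_not_injective_lt (ι := Fin h × Fin w) (α := α)
  simp only [Fintype.card_prod, Fintype.card_fin] at h2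
  have h3 := chain_blowup_count hp h w
  have h4 : ε ^ h ≤ (Nat.card {f : Fin h → α // ∀ ⦃i j⦄, i < j → p (f i) (f j)} : ℝ) /
      (Fintype.card α : ℝ) ^ h := by
    rwa [le_div_iff₀ (by positivity), ← mul_pow]
  have h5 : ((h : ℝ) ^ 2 * (w : ℝ) ^ 2 / Fintype.card α) * (Fintype.card α : ℝ) ^ (h * w) <
      ((h * w : ℕ) : ℝ) ^ 2 * (Fintype.card α : ℝ) ^ (h * w - 1) := by
    calc _ = (ε ^ h) ^ w ^ 2 * (Fintype.card α : ℝ) ^ (h * w) := by rw [← hpow, pow_mul]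
      _ ≤ _ := by gcongr
      _ ≤ _ := h3
      _ < _ := by exact_mod_cast h1.trans_lt h2
  have h6 : h * w = (h * w - 1) + 1 :=
    (Nat.succ_pred_eq_of_pos (Nat.mul_pos (Nat.pos_of_ne_zero hh) (Nat.pos_of_ne_zero hw))).symm
  have h7 : (Fintype.card α : ℝ) ^ (h * w) =
      (Fintype.card α : ℝ) ^ (h * w - 1) * Fintype.card α := by
    rw [← pow_succ, ← h6]
  rw [h7] at h5
  refine h5.ne ?_
  push_cast
  field_simp

/-- **Indistinguishability** (Theorem 3). Let `h = h(Ps) ≥ 2` and `w = w(Ps)`.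
(1) Every `C_h`-free finite poset is `Ps`-free.
(2) Every `Ps`-free finite poset `P` has a `C_h`-free subposet obtained by removing at most
`2·(h²w²/|P|)^{1/(hw²)}·|P|²` edges. -/
theorem poset_indistinguishability (Ps : Set FinPoset) (h2 : 2 ≤ famHeight Ps) :
    (∀ (α : Type) [Fintype α], ∀ p : α → α → Prop, IsStrictOrd p →
      ¬ HasChain p (famHeight Ps) → ∀ R ∈ Ps, ¬ ContainsAsSubposet R.rel p) ∧
    (∀ (α : Type) [Fintype α], ∀ p : α → α → Prop, IsStrictOrd p →
      (∀ R ∈ Ps, ¬ ContainsAsSubposet R.rel p) →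
      ∃ p' : α → α → Prop, IsStrictOrd p' ∧ SubposetRel p' p ∧
        ¬ HasChain p' (famHeight Ps) ∧
        (removedEdges p p' : ℝ) ≤
          2 * (((famHeight Ps : ℝ) ^ 2 * (famWidth Ps : ℝ) ^ 2 / (Fintype.card α : ℝ)) ^
              ((1 : ℝ) / ((famHeight Ps : ℝ) * (famWidth Ps : ℝ) ^ 2))) *
            (Fintype.card α : ℝ) ^ 2) := by
  constructor
  · intro α _ p hp hfree R hR hcon
    obtain ⟨f, -, hf⟩ := hcon
    obtain ⟨g, hg⟩ := hasChain_posetHeight R.strict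
    have hle : famHeight Ps ≤ posetHeight R.rel := Nat.sInf_le ⟨R, hR, rfl⟩
    exact hfree (HasChain.mono hle ⟨fun i => f (g i), fun i j hij => hf (hg hij)⟩)
  · intro α _ p hp hfree
    have hne : {m | ∃ P ∈ Ps, posetHeight P.rel = m}.Nonempty :=
      Nat.nonempty_of_pos_sInf (show 0 < famHeight Ps by omega)
    obtain ⟨Q₀, hQ₀, hQ₀h⟩ := Nat.sInf_mem hne
    obtain ⟨Q, hQ, hQh, hQw⟩ := Nat.sInf_mem
      (s := {m | ∃ P ∈ Ps, posetHeight P.rel = famHeight Ps ∧ posetWidth P.rel = m})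
      ⟨_, Q₀, hQ₀, hQ₀h, rfl⟩
    change posetWidth Q.rel = famWidth Ps at hQw
    rw [← hQh] at h2 ⊢
    rw [← hQw]
    have hw : posetWidth Q.rel ≠ 0 := by
      obtain ⟨g, -⟩ := hasChain_posetHeight Q.strict
      have h1 := card_le_posetWidth (p := Q.rel) (s := {g ⟨0, by omega⟩}) (by
        intro x hx y hy
        rw [Finset.mem_singleton] at hx hy
        rw [hx, hy]
        exact Q.strict.1 _)
      rw [Finset.card_singleton] at h1
      omega
    rcases isEmpty_or_nonempty α with hα | hα
    · refine ⟨p, hp, fun _ _ hxy => hxy, fun ⟨f, _⟩ => hα.elim (f ⟨0, by omega⟩), ?_⟩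
      have h0 : removedEdges p p = 0 := by
        have : IsEmpty {e : α × α // p e.1 e.2 ∧ ¬ p e.1 e.2} := ⟨fun e => e.2.2 e.2.1⟩
        exact Nat.card_of_isEmpty
      rw [h0]
      simp
    set h := posetHeight Q.rel
    set w := posetWidth Q.rel with hwdef
    set ε : ℝ := ((h : ℝ) ^ 2 * (w : ℝ) ^ 2 / (Fintype.card α : ℝ)) ^
      ((1 : ℝ) / ((h : ℝ) * (w : ℝ) ^ 2)) with hεdef
    have hε : 0 ≤ ε := by positivity
    have hpow : ε ^ (h * w ^ 2) = (h : ℝ) ^ 2 * (w : ℝ) ^ 2 / Fintype.card α := by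
      have hexp : (1 : ℝ) / ((h : ℝ) * (w : ℝ) ^ 2) = ((h * w ^ 2 : ℕ) : ℝ)⁻¹ := by
        push_cast
        rw [one_div]
      rw [hεdef, hexp]
      exact Real.rpow_inv_natCast_pow (by positivity)
        (Nat.mul_ne_zero (by omega) (pow_ne_zero _ hw))
    have hsucc : h - 1 + 1 = h := by omega
    by_cases hrich :
        (Nat.card {x // RichLevel p (ε * Fintype.card α) (h - 1) x} : ℝ) ≤ ε * Fintype.card α
    · obtain ⟨p', hp', hsub, hchain, hcard⟩ :=
        exists_chain_free_subposet hp (by omega : 1 ≤ h - 1) hrich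
      rw [hsucc] at hchain
      refine ⟨p', hp', hsub, hchain, hcard.trans_eq ?_⟩
      ring
    · have hmany := pow_le_card_chains hp (by positivity) (not_le.1 hrich).le
      rw [hsucc] at hmany
      exact absurd (containsAsSubposet_of_card_chains Q.strict (by omega) hw hp hε hpow hmany)
        (hfree Q hQ)
end

section
/- For every ε > 0, every integer h ≥ 2 and every finite poset P, if t(C_h,P) < (ε/2)^h, then there exists a C_h-free subposet of P obtained by the removal of at most ε·|P|² edges. -/
open scoped Classical in
/-- `richSet p c k` is the set of elements from which one can greedily climb `k` steps, having at
least `c` choices in each step. -/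
noncomputable def richSet {α : Type*} [Fintype α] (p : α → α → Prop) (c : ℝ) : ℕ → Finset α
  | 0 => Finset.univ
  | k + 1 => {x | c ≤ (({y | p x y ∧ y ∈ richSet p c k} : Finset α).card : ℝ)}

theorem mem_richSet_succ {α : Type*} [Fintype α] [DecidableEq α] (p : α → α → Prop)
    [DecidableRel p] (c : ℝ) (k : ℕ) (x : α) :
    x ∈ richSet p c (k + 1) ↔
      c ≤ (({y | p x y ∧ y ∈ richSet p c k} : Finset α).card : ℝ) := by
  classical
  rw [richSet, Finset.mem_filter_univ]
  convert Iff.rfl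

theorem richSet_antitone {α : Type*} [Fintype α] (p : α → α → Prop) (c : ℝ) :
    Antitone (richSet p c) := by
  classical
  refine antitone_nat_of_succ_le fun k => ?_
  induction k with
  | zero => exact Finset.subset_univ _
  | succ k ih =>
    intro x hx
    rw [mem_richSet_succ] at hx ⊢
    refine hx.trans ?_
    refine Nat.cast_le.mpr (Finset.card_le_card ?_)
    exact Finset.monotone_filter_right _ fun y _ hy => ⟨hy.1, ih hy.2⟩

theorem isPosetHom_chainRel_cons {α : Type*} {p : α → α → Prop} (hp : IsStrictOrd p) {k : ℕ}
    {x : α} {f : Fin (k + 1) → α} (hf : IsPosetHom (chainRel (k + 1)) p f) (hx : p x (f 0)) :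
    IsPosetHom (chainRel (k + 2)) p (Fin.cons x f : Fin (k + 2) → α) := by
  intro i j hij
  rw [chainRel] at hij
  induction j using Fin.cases with
  | zero => exact absurd hij (Fin.not_lt_zero i)
  | succ j =>
    induction i using Fin.cases with
    | zero =>
      rw [Fin.cons_zero, Fin.cons_succ]
      rcases (Fin.zero_le j).eq_or_lt with h0 | h0
      · rwa [← h0]
      · exact hp.2 hx (hf h0)
    | succ i =>
      rw [Fin.cons_succ, Fin.cons_succ]
      exact hf (Fin.succ_lt_succ_iff.mp hij)

open scoped Classical in
theorem pow_le_card_chains_from {α : Type*} [Fintype α] {p : α → α → Prop} (hp : IsStrictOrd p)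
    {c : ℝ} (hc : 0 ≤ c) (k : ℕ) {x : α} (hx : x ∈ richSet p c k) :
    c ^ k ≤ (({f | IsPosetHom (chainRel (k + 1)) p f ∧ f 0 = x} :
      Finset (Fin (k + 1) → α)).card : ℝ) := by
  induction k generalizing x with
  | zero =>
    rw [pow_zero, Nat.one_le_cast, Nat.one_le_iff_ne_zero, ← Nat.pos_iff_ne_zero,
      Finset.card_pos]
    refine ⟨fun _ => x, ?_⟩
    rw [Finset.mem_filter_univ]
    refine ⟨fun i j hij => ?_, rfl⟩
    exact absurd hij (by simp [chainRel, Fin.eq_zero])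
  | succ k ih =>
    rw [mem_richSet_succ] at hx
    set Y : Finset α := {y | p x y ∧ y ∈ richSet p c k}
    let S : α → Finset (Fin (k + 1) → α) :=
      fun y => {f | IsPosetHom (chainRel (k + 1)) p f ∧ f 0 = y}
    have hdisj : (Y : Set α).PairwiseDisjoint S := by
      intro y _ z _ hyz
      refine Finset.disjoint_left.mpr fun f hfy hfz => hyz ?_
      simp only [S, Finset.mem_filter_univ] at hfy hfz
      exact hfy.2.symm.trans hfz.2
    have hinj : Function.Injective (fun f => Fin.cons x f : (Fin (k + 1) → α) → Fin (k + 2) → α) :=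
      Fin.cons_right_injective (α := fun _ => α) x
    have hle : (Y.biUnion S).card ≤ (({f | IsPosetHom (chainRel (k + 2)) p f ∧ f 0 = x} :
        Finset (Fin (k + 2) → α)).card) := by
      rw [← Finset.card_image_of_injective _ hinj]
      refine Finset.card_le_card fun g hg => ?_
      simp only [Finset.mem_image, Finset.mem_biUnion, S, Y, Finset.mem_filter_univ] at hg
      obtain ⟨f, ⟨y, ⟨hxy, _⟩, hf, rfl⟩, rfl⟩ := hg
      rw [Finset.mem_filter_univ]
      exact ⟨isPosetHom_chainRel_cons hp hf hxy, Fin.cons_zero _ _⟩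
    calc c ^ (k + 1) = c * c ^ k := pow_succ' c k
      _ ≤ Y.card * c ^ k := by gcongr
      _ = ∑ y ∈ Y, c ^ k := by rw [Finset.sum_const, nsmul_eq_mul]
      _ ≤ ∑ y ∈ Y, ((S y).card : ℝ) :=
          Finset.sum_le_sum fun y hy => ih ((Finset.mem_filter_univ y).mp hy).2
      _ = (Y.biUnion S).card := by rw [Finset.card_biUnion hdisj, Nat.cast_sum]
      _ ≤ _ := by exact_mod_cast hle

theorem card_richSet_mul_pow_le {α : Type*} [Fintype α] {p : α → α → Prop}
    (hp : IsStrictOrd p) {c : ℝ} (hc : 0 ≤ c) (k : ℕ) :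
    (richSet p c k).card * c ^ k ≤
      (Nat.card {f : Fin (k + 1) → α // IsPosetHom (chainRel (k + 1)) p f} : ℝ) := by
  classical
  let S : α → Finset (Fin (k + 1) → α) :=
    fun y => {f | IsPosetHom (chainRel (k + 1)) p f ∧ f 0 = y}
  have hdisj : (richSet p c k : Set α).PairwiseDisjoint S := by
    intro y _ z _ hyz
    refine Finset.disjoint_left.mpr fun f hfy hfz => hyz ?_
    simp only [S, Finset.mem_filter_univ] at hfy hfz
    exact hfy.2.symm.trans hfz.2
  have hle : ((richSet p c k).biUnion S).card ≤
      Nat.card {f : Fin (k + 1) → α // IsPosetHom (chainRel (k + 1)) p f} := by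
    rw [Nat.card_eq_fintype_card, Fintype.card_subtype]
    refine Finset.card_le_card fun f hf => ?_
    simp only [Finset.mem_biUnion, S, Finset.mem_filter_univ] at hf ⊢
    obtain ⟨_, _, hf, _⟩ := hf
    exact hf
  calc (richSet p c k).card * c ^ k = ∑ y ∈ richSet p c k, c ^ k := by
        rw [Finset.sum_const, nsmul_eq_mul]
    _ ≤ ∑ y ∈ richSet p c k, ((S y).card : ℝ) :=
        Finset.sum_le_sum fun y hy => pow_le_card_chains_from hp hc k hy
    _ = ((richSet p c k).biUnion S).card := by rw [Finset.card_biUnion hdisj, Nat.cast_sum]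
    _ ≤ _ := by exact_mod_cast hle

theorem card_richSet_lt {α : Type*} [Fintype α] [Nonempty α] {p : α → α → Prop}
    (hp : IsStrictOrd p) {m : ℕ} {δ : ℝ} (hδ : 0 < δ)
    (hdens : homDensity (chainRel (m + 1)) p < δ ^ (m + 1)) :
    ((richSet p (δ * Fintype.card α) m).card : ℝ) < δ * Fintype.card α := by
  have hn : (0 : ℝ) < Fintype.card α := by exact_mod_cast Fintype.card_pos
  have hc : 0 < δ * Fintype.card α := mul_pos hδ hn
  rw [homDensity, Fintype.card_fin, div_lt_iff₀ (by positivity), ← mul_pow, pow_succ'] at hdens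
  exact lt_of_mul_lt_mul_right ((card_richSet_mul_pow_le hp hc.le m).trans_lt hdens)
    (by positivity)

theorem not_hasChain_of_strictAnti {α : Type*} {q : α → α → Prop} {m : ℕ} (hm : 1 ≤ m)
    (l : α → ℕ) (hq : ∀ x y, q x y → l y < l x ∧ l x < m) : ¬ HasChain q (m + 1) := by
  rintro ⟨f, hf⟩
  have key : ∀ i : ℕ, (hi : i < m + 1) → l (f ⟨i, hi⟩) + i ≤ l (f 0) := by
    intro i
    induction i with
    | zero => exact fun _ => le_rfl
    | succ i ih =>
      intro hi
      have h1 := ih (Nat.lt_of_succ_lt hi)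
      have h2 := (hq _ _ (hf (show (⟨i, Nat.lt_of_succ_lt hi⟩ : Fin (m + 1)) < ⟨i + 1, hi⟩ from
        Nat.lt_succ_self i))).1
      omega
  have h1 := key m (Nat.lt_succ_self m)
  have h2 := (hq _ _ (hf (show (0 : Fin (m + 1)) < ⟨m, Nat.lt_succ_self m⟩ from hm))).2
  omega

theorem removedEdges_eq_sum {α : Type*} [Fintype α] [DecidableEq α] (p p' : α → α → Prop)
    [DecidableRel p] [DecidableRel p'] :
    removedEdges p p' = ∑ x, ({y | p x y ∧ ¬ p' x y} : Finset α).card := by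
  rw [removedEdges, Nat.card_eq_fintype_card, Fintype.card_subtype,
    Finset.card_filter, Fintype.sum_prod_type]
  exact Finset.sum_congr rfl fun x _ => (Finset.card_filter _ _).symm

/-- **Removal lemma for chains** (Lemma 5). If `t(C_h,P) < (ε/2)^h` then one can remove
at most `ε·|P|²` edges from `P` to obtain a `C_h`-free subposet. -/
theorem chain_removal_lemma {α : Type*} [Fintype α] (p : α → α → Prop)
    (hp : IsStrictOrd p) (h : ℕ) (hh : 2 ≤ h) (ε : ℝ) (hε : 0 < ε)
    (hdens : homDensity (chainRel h) p < (ε / 2) ^ h) :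
    ∃ p' : α → α → Prop, IsStrictOrd p' ∧ SubposetRel p' p ∧ ¬ HasChain p' h ∧
      (removedEdges p p' : ℝ) ≤ ε * (Fintype.card α : ℝ) ^ 2 := by
  classical
  obtain ⟨m, rfl⟩ : ∃ m, h = m + 1 := ⟨h - 1, by omega⟩
  set c : ℝ := ε / 2 * Fintype.card α with hc
  let l : α → ℕ := fun x => Nat.findGreatest (fun k => x ∈ richSet p c k) m
  have hlm : ∀ x, l x ≤ m := fun x => Nat.findGreatest_le m
  have hl : ∀ x, x ∈ richSet p c (l x) := fun x =>
    Nat.findGreatest_spec (P := fun k => x ∈ richSet p c k) (Nat.zero_le m)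
      (by rw [richSet]; exact Finset.mem_univ x)
  have hl' : ∀ x, l x < m → x ∉ richSet p c (l x + 1) := fun x hx =>
    Nat.findGreatest_is_greatest (P := fun k => x ∈ richSet p c k) (Nat.lt_succ_self _) hx
  let p' : α → α → Prop := fun x y => p x y ∧ l y < l x ∧ l x < m
  refine ⟨p', ⟨fun x hx => hp.1 x hx.1, fun x y z hxy hyz =>
    ⟨hp.2 hxy.1 hyz.1, hyz.2.1.trans hxy.2.1, hxy.2.2⟩⟩, fun x y hxy => hxy.1,
    not_hasChain_of_strictAnti (by omega) l fun x y hxy => hxy.2, ?_⟩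
  rcases isEmpty_or_nonempty α with hα | hα
  · simp [removedEdges]
  have hcard := card_richSet_lt hp (half_pos hε) hdens
  rw [← hc] at hcard
  have hdeg : ∀ x, ((({y | p x y ∧ ¬ p' x y} : Finset α).card : ℕ) : ℝ) ≤
      c + if x ∈ richSet p c m then (Fintype.card α : ℝ) else 0 := by
    intro x
    rcases (hlm x).eq_or_lt with hx | hx
    · rw [if_pos (hx ▸ hl x)]
      have h1 : ((({y | p x y ∧ ¬ p' x y} : Finset α).card : ℕ) : ℝ) ≤ Fintype.card α := by
        exact_mod_cast Finset.card_le_univ _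
      have h2 : 0 ≤ c := by positivity
      linarith
    · have h1 := hl' x hx
      rw [mem_richSet_succ, not_le] at h1
      have h2 : (({y | p x y ∧ ¬ p' x y} : Finset α)).card ≤
          ({y | p x y ∧ y ∈ richSet p c (l x)} : Finset α).card := by
        refine Finset.card_le_card (Finset.monotone_filter_right _ fun y _ hy => ⟨hy.1, ?_⟩)
        have h3 : l x ≤ l y := not_lt.mp fun h => hy.2 ⟨hy.1, h, hx⟩
        exact richSet_antitone p c h3 (hl y)
      have h3 : (0 : ℝ) ≤ if x ∈ richSet p c m then (Fintype.card α : ℝ) else 0 := by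
        positivity
      exact ((Nat.cast_le.mpr h2).trans h1.le).trans (le_add_of_nonneg_right h3)
  calc (removedEdges p p' : ℝ)
      = ∑ x, ((({y | p x y ∧ ¬ p' x y} : Finset α).card : ℕ) : ℝ) := by
        rw [removedEdges_eq_sum, Nat.cast_sum]
    _ ≤ ∑ x, (c + if x ∈ richSet p c m then (Fintype.card α : ℝ) else 0) :=
        Finset.sum_le_sum fun x _ => hdeg x
    _ = Fintype.card α * c + (richSet p c m).card * Fintype.card α := by
        rw [Finset.sum_add_distrib, Finset.sum_ite_mem, Finset.univ_inter]
        simp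
    _ ≤ Fintype.card α * c + c * Fintype.card α := by gcongr
    _ = ε * (Fintype.card α : ℝ) ^ 2 := by rw [hc]; ring
end
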